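/- Γ⁵₂ is a normal subgroup of Γ⁵, and Σ⁵ is a complete set of coset representatives for Γ⁵₂ in Γ⁵: every matrix A ∈ Γ⁵ can be written uniquely as A = B·C with B ∈ Γ⁵₂ and C ∈ Σ⁵. In particular there is a split short exact sequence 1 → Γ⁵₂ → Γ⁵ → Σ⁵ → 1, i.e., Γ⁵ is the internal semidirect product of Γ⁵₂ and Σ⁵. -/

import Mathlib

open Matrix

/-- The matrix `J = diag(1,1,1,1,1,-1)` of the Lorentzian quadratic form. -/
def lorJ : Matrix (Fin 6) (Fin 6) ℤ := Matrix.diagonal ![1, 1, 1, 1, 1, -1]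

/-- A 6×6 matrix is Lorentzian if `Aᵀ J A = J`. -/
def IsLorentzian (A : Matrix (Fin 6) (Fin 6) ℤ) : Prop := Aᵀ * lorJ * A = lorJ

/-- A Lorentzian matrix is positive if its (6,6) entry is positive. -/
def IsPosLorentzian (A : Matrix (Fin 6) (Fin 6) ℤ) : Prop := IsLorentzian A ∧ 0 < A 5 5

/-- A matrix is congruent to the identity matrix modulo two. -/
def CongrIdModTwo (A : Matrix (Fin 6) (Fin 6) ℤ) : Prop :=
  ∀ i j, (2 : ℤ) ∣ (A i j - (1 : Matrix (Fin 6) (Fin 6) ℤ) i j)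

/-- Permutation matrix of the transposition (1 2). -/
def P12 : Matrix (Fin 6) (Fin 6) ℤ :=
  !![0,1,0,0,0,0; 1,0,0,0,0,0; 0,0,1,0,0,0; 0,0,0,1,0,0; 0,0,0,0,1,0; 0,0,0,0,0,1]

/-- Permutation matrix of the transposition (2 3). -/
def P23 : Matrix (Fin 6) (Fin 6) ℤ :=
  !![1,0,0,0,0,0; 0,0,1,0,0,0; 0,1,0,0,0,0; 0,0,0,1,0,0; 0,0,0,0,1,0; 0,0,0,0,0,1]

/-- Permutation matrix of the transposition (3 4). -/
def P34 : Matrix (Fin 6) (Fin 6) ℤ :=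
  !![1,0,0,0,0,0; 0,1,0,0,0,0; 0,0,0,1,0,0; 0,0,1,0,0,0; 0,0,0,0,1,0; 0,0,0,0,0,1]

/-- Permutation matrix of the transposition (4 5). -/
def P45 : Matrix (Fin 6) (Fin 6) ℤ :=
  !![1,0,0,0,0,0; 0,1,0,0,0,0; 0,0,1,0,0,0; 0,0,0,0,1,0; 0,0,0,1,0,0; 0,0,0,0,0,1]

/-- The matrix `V`. -/
def Vmat : Matrix (Fin 6) (Fin 6) ℤ :=
  !![0,-1,-1,0,0,1; -1,0,-1,0,0,1; -1,-1,0,0,0,1;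
     0,0,0,1,0,0; 0,0,0,0,1,0; -1,-1,-1,0,0,2]

/-- The generators of `Σ⁵`, as a family. -/
def sigGen : Fin 5 → Matrix (Fin 6) (Fin 6) ℤ := ![P12, P23, P34, P45, Vmat]

/-- The action of the generators of `Σ⁵` on vectors modulo two. -/
def sigAct (i : Fin 5) (v : Fin 6 → ZMod 2) : Fin 6 → ZMod 2 :=
  match i with
  | 0 => ![v 1, v 0, v 2, v 3, v 4, v 5]
  | 1 => ![v 0, v 2, v 1, v 3, v 4, v 5]
  | 2 => ![v 0, v 1, v 3, v 2, v 4, v 5]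
  | 3 => ![v 0, v 1, v 2, v 4, v 3, v 5]
  | 4 => ![v 1 + v 2 + v 5, v 0 + v 2 + v 5, v 0 + v 1 + v 5, v 3, v 4, v 0 + v 1 + v 2]

/-- The `j`-th column of an integer matrix, reduced modulo two. -/
def colMod (A : Matrix (Fin 6) (Fin 6) ℤ) (j : Fin 6) : Fin 6 → ZMod 2 := fun k => (A k j : ZMod 2)

/-- The Lorentzian norm modulo four, which depends only on the vector modulo two. -/
def normMod (v : Fin 6 → ZMod 2) : ZMod 4 :=
  (v 0).val + (v 1).val + (v 2).val + (v 3).val + (v 4).val - (v 5).val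

/-- For each index `t`, words in the generators fixing the basis vectors after the `t`-th among the
first five, which together move every admissible vector modulo two to the `t`-th basis vector. -/
def sigWords (t : Fin 6) : List (List (Fin 5)) :=
  match t with
  | 4 => [[], [3], [3, 2], [3, 2, 1], [3, 2, 4], [3, 2, 1, 0], [3, 2, 1, 4], [3, 2, 1, 0, 4],
      [3, 2, 1, 4, 2], [3, 2, 1, 0, 4, 2], [3, 2, 1, 4, 2, 3], [3, 2, 1, 0, 4, 2, 1],
      [3, 2, 1, 0, 4, 2, 3], [3, 2, 1, 0, 4, 2, 1, 3], [3, 2, 1, 0, 4, 2, 1, 3, 2],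
      [3, 2, 1, 0, 4, 2, 1, 3, 2, 4]]
  | 3 => [[], [2], [2, 1], [2, 4], [2, 1, 0], [2, 1, 4], [2, 1, 0, 4], [2, 1, 4, 2],
      [2, 1, 0, 4, 2], [2, 1, 0, 4, 2, 1]]
  | 2 => [[], [1], [4], [1, 0], [1, 4], [1, 0, 4]]
  | 1 => [[], [0]]
  | _ => [[]]

theorem colMod_sigGen_mul (i : Fin 5) (A : Matrix (Fin 6) (Fin 6) ℤ) (j : Fin 6) :
    colMod (sigGen i * A) j = sigAct i (colMod A j) := by
  have h2 : (2 : ZMod 2) = 0 := by decide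
  ext k
  fin_cases i <;> fin_cases k <;>
    simp [colMod, sigGen, sigAct, P12, P23, P34, P45, Vmat, Matrix.mul_apply, Fin.sum_univ_six,
      ZMod.neg_eq_self_mod_two, h2]

theorem colMod_prod_mul (w : List (Fin 5)) (A : Matrix (Fin 6) (Fin 6) ℤ) (j : Fin 6) :
    colMod ((w.map sigGen).prod * A) j = w.foldr sigAct (colMod A j) := by
  induction w with
  | nil => simp
  | cons i w ih => simp [mul_assoc, colMod_sigGen_mul, ih]

theorem sq_cast_zmod_four (x : ℤ) : (x : ZMod 4) * x = ((x : ZMod 2).val : ZMod 4) := by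
  have h : ∀ y : ZMod 4, y * y = ((ZMod.castHom (by decide : 2 ∣ 4) (ZMod 2) y).val : ZMod 4) := by
    decide
  simpa using h x

theorem IsLorentzian.sum_eq {A : Matrix (Fin 6) (Fin 6) ℤ} (h : IsLorentzian A) (i j : Fin 6) :
    A 0 i * A 0 j + A 1 i * A 1 j + A 2 i * A 2 j + A 3 i * A 3 j + A 4 i * A 4 j - A 5 i * A 5 j =
      lorJ i j := by
  have h' := congrFun (congrFun h i) j
  rw [← h']
  simp [Matrix.mul_apply, lorJ, Fin.sum_univ_six, Matrix.diagonal_apply]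
  ring

theorem IsLorentzian.normMod_colMod {A : Matrix (Fin 6) (Fin 6) ℤ} (h : IsLorentzian A)
    (j : Fin 6) : normMod (colMod A j) = (lorJ j j : ZMod 4) := by
  rw [← h.sum_eq j j]
  simp only [normMod, colMod, ← sq_cast_zmod_four]
  push_cast
  ring

theorem IsLorentzian.dotProduct_colMod {A : Matrix (Fin 6) (Fin 6) ℤ} (h : IsLorentzian A)
    {i j : Fin 6} (hij : i ≠ j) : colMod A i ⬝ᵥ colMod A j = 0 := by
  have h' := congrArg (Int.cast : ℤ → ZMod 2) (h.sum_eq i j)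
  rw [lorJ, Matrix.diagonal_apply_ne _ hij, sub_eq_add_neg] at h'
  push_cast at h'
  rw [ZMod.neg_eq_self_mod_two] at h'
  simpa [dotProduct, Fin.sum_univ_six, colMod] using h'

theorem exists_mem_sigWords : ∀ t : Fin 6, t ∈ ({1, 2, 3, 4} : Finset (Fin 6)) →
    ∀ v : Fin 6 → ZMod 2, normMod v = 1 → (∀ j, t < j → j < 5 → v j = 0) → (t = 1 → v 5 = 0) →
      ∃ w ∈ sigWords t, w.foldr sigAct v = Pi.single t 1 := by
  decide +kernel

theorem foldr_sigWords : ∀ t : Fin 6, ∀ w ∈ sigWords t, ∀ j, t < j → j < 5 →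
    w.foldr sigAct (Pi.single j 1) = Pi.single j 1 := by
  decide +kernel

theorem eq_single_of_normMod : ∀ v : Fin 6 → ZMod 2, v 2 = 0 → v 3 = 0 → v 4 = 0 →
    normMod v = -1 → v = Pi.single 5 1 := by
  decide +kernel

theorem eq_single_zero_of_normMod : ∀ v : Fin 6 → ZMod 2, (∀ j, 0 < j → v j = 0) →
    normMod v = 1 → v = Pi.single 0 1 := by
  decide +kernel

theorem congrIdModTwo_iff_colMod {A : Matrix (Fin 6) (Fin 6) ℤ} :
    CongrIdModTwo A ↔ ∀ j, colMod A j = Pi.single j 1 := by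
  rw [CongrIdModTwo, forall_comm]
  refine forall_congr' fun j => ?_
  rw [funext_iff]
  refine forall_congr' fun i => ?_
  have h := ZMod.intCast_zmod_eq_zero_iff_dvd (A i j - (1 : Matrix (Fin 6) (Fin 6) ℤ) i j) 2
  push_cast at h
  rw [← h, sub_eq_zero, colMod, Matrix.one_apply, Pi.single_apply]
  push_cast
  rfl

theorem congrIdModTwo_iff_map {A : GL (Fin 6) ℤ} :
    CongrIdModTwo (A : Matrix (Fin 6) (Fin 6) ℤ) ↔
      Matrix.GeneralLinearGroup.map (Int.castRingHom (ZMod 2)) A = 1 := by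
  rw [congrIdModTwo_iff_colMod, Units.ext_iff, ← Matrix.ext_iff, forall_comm]
  refine forall_congr' fun j => ?_
  rw [funext_iff]
  refine forall_congr' fun i => ?_
  simp [colMod, Matrix.one_apply, Pi.single_apply]

theorem isPosLorentzian_sigGen (i : Fin 5) : IsPosLorentzian (sigGen i) := by
  revert i
  unfold IsPosLorentzian IsLorentzian
  decide +kernel

theorem IsLorentzian.apply_eq_zero {A : Matrix (Fin 6) (Fin 6) ℤ} (h : IsLorentzian A)
    {i j : Fin 6} (hij : i ≠ j) (hj : colMod A j = Pi.single j 1) : colMod A i j = 0 := by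
  simpa [hj] using h.dotProduct_colMod hij

/-- The vector `(1,1,1,1,1,3)` fixed by `Σ⁵`. -/
def sigVec : Fin 6 → ℤ := ![1, 1, 1, 1, 1, 3]

theorem sigGen_mulVec_sigVec : ∀ i, sigGen i *ᵥ sigVec = sigVec := by
  decide +kernel

/-- A vector `u` orthogonal to `(1,1,1,1,1,3)` whose norm is minus its first coordinate vanishes. -/
theorem eq_zero_of_norm_eq_neg {a b c d e f : ℤ} (hs : a + b + c + d + e = 3 * f)
    (hn : a * a + b * b + c * c + d * d + e * e - f * f = -a) :
    a = 0 ∧ b = 0 ∧ c = 0 ∧ d = 0 ∧ e = 0 ∧ f = 0 := by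
  have hc : 9 * (f * f) ≤ 5 * (a * a + b * b + c * c + d * d + e * e) := by
    have : 9 * (f * f) = (a + b + c + d + e) * (a + b + c + d + e) := by rw [hs]; ring
    nlinarith [sq_nonneg (a - b), sq_nonneg (a - c), sq_nonneg (a - d), sq_nonneg (a - e),
      sq_nonneg (b - c), sq_nonneg (b - d), sq_nonneg (b - e), sq_nonneg (c - d),
      sq_nonneg (c - e), sq_nonneg (d - e)]
  have hb := mul_self_nonneg b
  have hc' := mul_self_nonneg c
  have hd := mul_self_nonneg d
  have he := mul_self_nonneg e
  have hf := mul_self_nonneg f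
  have ha : 4 * (a * a) ≤ -9 * a := by linarith
  have ha0 : a ≤ 0 := by nlinarith [mul_self_nonneg a]
  have ha2 : -2 ≤ a := by nlinarith
  have heven : Even a := by
    have key : ∀ x : ℤ, ∃ k, x * x = x + 2 * k := fun x => by
      obtain ⟨k, hk⟩ := Int.even_mul_pred_self x
      exact ⟨k, by linarith⟩
    obtain ⟨ka, hka⟩ := key a
    obtain ⟨kb, hkb⟩ := key b
    obtain ⟨kc, hkc⟩ := key c
    obtain ⟨kd, hkd⟩ := key d
    obtain ⟨ke, hke⟩ := key e
    obtain ⟨kf, hkf⟩ := key f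
    rw [Int.even_iff]
    omega
  have hcases : a = 0 ∨ a = -2 := by
    obtain ⟨k, hk⟩ := heven
    omega
  rcases hcases with rfl | rfl
  · refine ⟨rfl, ?_, ?_, ?_, ?_, ?_⟩ <;> apply mul_self_eq_zero.mp <;> linarith
  · have hb0 : b = 0 := mul_self_eq_zero.mp (by omega)
    have hc0 : c = 0 := mul_self_eq_zero.mp (by omega)
    have hd0 : d = 0 := mul_self_eq_zero.mp (by omega)
    have he0 : e = 0 := mul_self_eq_zero.mp (by omega)
    omega

/-- A Lorentzian matrix congruent to the identity modulo two and fixing `(1,1,1,1,1,3)` is the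
identity. -/
theorem IsLorentzian.eq_one {A : Matrix (Fin 6) (Fin 6) ℤ} (h : IsLorentzian A)
    (hA : CongrIdModTwo A) (hw : A *ᵥ sigVec = sigVec) : A = 1 := by
  have hrow : ∀ j, A 0 j + A 1 j + A 2 j + A 3 j + A 4 j - 3 * A 5 j = (lorJ *ᵥ sigVec) j := by
    intro j
    have h' : Aᵀ *ᵥ (lorJ *ᵥ sigVec) = lorJ *ᵥ sigVec := by
      conv_lhs => rw [← hw]
      rw [Matrix.mulVec_mulVec, Matrix.mulVec_mulVec, h]
    rw [← h']
    simp [Matrix.mulVec, dotProduct, Fin.sum_univ_six, lorJ, sigVec, Matrix.diagonal_apply]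
    ring
  choose u hu using hA
  have hu' : ∀ i j, A i j = (1 : Matrix (Fin 6) (Fin 6) ℤ) i j + 2 * u i j := fun i j => by
    linarith [hu i j]
  have hcol : ∀ j, j ≠ 5 → ∀ i, u i j = 0 := by
    intro j hj i
    have hs := hrow j
    have hn := h.sum_eq j j
    simp only [hu'] at hs hn
    fin_cases j
    · simp [lorJ, sigVec, Matrix.mulVec_diagonal, Matrix.one_apply] at hs hn
      obtain ⟨h0, h1, h2, h3, h4, h5⟩ :=
        eq_zero_of_norm_eq_neg (a := u 0 0) (b := u 1 0) (c := u 2 0) (d := u 3 0) (e := u 4 0)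
          (f := u 5 0) (by linarith) (by linarith)
      fin_cases i <;> assumption
    · simp [lorJ, sigVec, Matrix.mulVec_diagonal, Matrix.one_apply] at hs hn
      obtain ⟨h1, h0, h2, h3, h4, h5⟩ :=
        eq_zero_of_norm_eq_neg (a := u 1 1) (b := u 0 1) (c := u 2 1) (d := u 3 1) (e := u 4 1)
          (f := u 5 1) (by linarith) (by linarith)
      fin_cases i <;> assumption
    · simp [lorJ, sigVec, Matrix.mulVec_diagonal, Matrix.one_apply] at hs hn
      obtain ⟨h2, h0, h1, h3, h4, h5⟩ :=
        eq_zero_of_norm_eq_neg (a := u 2 2) (b := u 0 2) (c := u 1 2) (d := u 3 2) (e := u 4 2)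
          (f := u 5 2) (by linarith) (by linarith)
      fin_cases i <;> assumption
    · simp [lorJ, sigVec, Matrix.mulVec_diagonal, Matrix.one_apply] at hs hn
      obtain ⟨h3, h0, h1, h2, h4, h5⟩ :=
        eq_zero_of_norm_eq_neg (a := u 3 3) (b := u 0 3) (c := u 1 3) (d := u 2 3) (e := u 4 3)
          (f := u 5 3) (by linarith) (by linarith)
      fin_cases i <;> assumption
    · simp [lorJ, sigVec, Matrix.mulVec_diagonal, Matrix.one_apply] at hs hn
      obtain ⟨h4, h0, h1, h2, h3, h5⟩ :=
        eq_zero_of_norm_eq_neg (a := u 4 4) (b := u 0 4) (c := u 1 4) (d := u 2 4) (e := u 3 4)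
          (f := u 5 4) (by linarith) (by linarith)
      fin_cases i <;> assumption
    · exact absurd rfl hj
  have hlast : ∀ i, u i 5 = 0 := by
    intro i
    have h' := congrFun hw i
    simp only [Matrix.mulVec, dotProduct, Fin.sum_univ_six, hu', hcol 0 (by decide),
      hcol 1 (by decide), hcol 2 (by decide), hcol 3 (by decide), hcol 4 (by decide)] at h'
    fin_cases i <;> simp [sigVec, Matrix.one_apply] at h' ⊢ <;> omega
  ext i j
  rw [hu' i j]
  by_cases hj : j = 5
  · simp [hj, hlast]
  · simp [hcol j hj]

/-- Multiplying by a word in the generators normalizes one more column modulo two. -/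
theorem exists_word_normalizing_column (A : Matrix (Fin 6) (Fin 6) ℤ) (hA : IsLorentzian A)
    (t : Fin 6) (ht : t ∈ ({1, 2, 3, 4} : Finset (Fin 6)))
    (hcol : ∀ j, t < j → j < 5 → colMod A j = Pi.single j 1) :
    ∃ w : List (Fin 5), ∀ j, t ≤ j → j < 5 →
      colMod ((w.map sigGen).prod * A) j = Pi.single j 1 := by
  have hnorm : normMod (colMod A t) = 1 := by
    rw [hA.normMod_colMod]
    fin_cases ht <;> decide
  have h5 : t = 1 → colMod A t 5 = 0 := by
    rintro rfl
    refine hA.apply_eq_zero (by decide) (eq_single_of_normMod _ ?_ ?_ ?_ ?_)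
    · exact hA.apply_eq_zero (by decide) (hcol 2 (by decide) (by decide))
    · exact hA.apply_eq_zero (by decide) (hcol 3 (by decide) (by decide))
    · exact hA.apply_eq_zero (by decide) (hcol 4 (by decide) (by decide))
    · rw [hA.normMod_colMod]
      decide
  obtain ⟨w, hw, hwt⟩ := exists_mem_sigWords t ht (colMod A t) hnorm
    (fun j hj hj5 => hA.apply_eq_zero hj.ne (hcol j hj hj5)) h5
  refine ⟨w, fun j hj hj5 => ?_⟩
  rw [colMod_prod_mul]
  rcases hj.eq_or_lt with rfl | hlt
  · exact hwt
  · rw [hcol j hlt hj5, foldr_sigWords t w hw j hlt hj5]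

theorem congrIdModTwo_of_colMod {A : Matrix (Fin 6) (Fin 6) ℤ} (hA : IsLorentzian A)
    (hcol : ∀ j : Fin 6, 1 ≤ j → j < 5 → colMod A j = Pi.single j 1) : CongrIdModTwo A := by
  have h5 : colMod A 5 = Pi.single 5 1 := by
    refine eq_single_of_normMod _ ?_ ?_ ?_ ?_
    · exact hA.apply_eq_zero (by decide) (hcol 2 (by decide) (by decide))
    · exact hA.apply_eq_zero (by decide) (hcol 3 (by decide) (by decide))
    · exact hA.apply_eq_zero (by decide) (hcol 4 (by decide) (by decide))
    · rw [hA.normMod_colMod]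
      decide
  have hpos : ∀ j : Fin 6, 0 < j → colMod A j = Pi.single j 1 := by
    intro j hj
    rcases (Fin.le_last j).eq_or_lt with rfl | hlt
    · exact h5
    · exact hcol j (Fin.one_le_of_ne_zero hj.ne') hlt
  rw [congrIdModTwo_iff_colMod]
  intro j
  rcases (Fin.zero_le j).eq_or_lt with rfl | hlt
  · refine eq_single_zero_of_normMod _ (fun j hj => hA.apply_eq_zero hj.ne (hpos j hj)) ?_
    rw [hA.normMod_colMod]
    decide
  · exact hpos j hlt

/-- Every element of a group of Lorentzian matrices containing the generators of `Σ⁵` is congruent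
to the inverse of an element of `Σ⁵` modulo two. -/
theorem exists_mem_closure_congrIdModTwo {Γ : Subgroup (GL (Fin 6) ℤ)}
    (hΓ : ∀ A ∈ Γ, IsLorentzian (A : Matrix (Fin 6) (Fin 6) ℤ)) {g : Fin 5 → GL (Fin 6) ℤ}
    (hg : ∀ i, (g i : Matrix (Fin 6) (Fin 6) ℤ) = sigGen i) (hgΓ : ∀ i, g i ∈ Γ)
    {A : GL (Fin 6) ℤ} (hA : A ∈ Γ) :
    ∃ C ∈ Subgroup.closure (Set.range g),
      CongrIdModTwo ((C * A : GL (Fin 6) ℤ) : Matrix (Fin 6) (Fin 6) ℤ) := by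
  have hle : Subgroup.closure (Set.range g) ≤ Γ := by
    rw [Subgroup.closure_le]
    rintro _ ⟨i, rfl⟩
    exact hgΓ i
  have step : ∀ s t : Fin 6, t ∈ ({1, 2, 3, 4} : Finset (Fin 6)) → (∀ j, t < j ↔ s ≤ j) →
      (∃ C ∈ Subgroup.closure (Set.range g), ∀ j, s ≤ j → j < 5 →
        colMod ((C * A : GL (Fin 6) ℤ) : Matrix (Fin 6) (Fin 6) ℤ) j = Pi.single j 1) →
      ∃ C ∈ Subgroup.closure (Set.range g), ∀ j, t ≤ j → j < 5 →
        colMod ((C * A : GL (Fin 6) ℤ) : Matrix (Fin 6) (Fin 6) ℤ) j = Pi.single j 1 := by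
    rintro s t ht hst ⟨C, hC, hcol⟩
    obtain ⟨w, hw⟩ := exists_word_normalizing_column _ (hΓ _ (mul_mem (hle hC) hA)) t ht
      fun j hj => hcol j ((hst j).mp hj)
    have hprod : ((w.map g).prod : GL (Fin 6) ℤ).val = (w.map sigGen).prod := by
      rw [← Units.coeHom_apply, map_list_prod, List.map_map]
      congr 2
      exact funext hg
    refine ⟨(w.map g).prod * C, mul_mem (list_prod_mem fun x hx => ?_) hC, fun j hj hj5 => ?_⟩
    · obtain ⟨i, -, rfl⟩ := List.mem_map.mp hx
      exact Subgroup.subset_closure ⟨i, rfl⟩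
    · rw [mul_assoc, Units.val_mul, hprod]
      exact hw j hj hj5
  obtain ⟨C, hC, hcol⟩ := step 2 1 (by decide) (by decide) <| step 3 2 (by decide) (by decide) <|
    step 4 3 (by decide) (by decide) <| step 5 4 (by decide) (by decide)
      ⟨1, one_mem _, fun j hj hj5 => absurd hj5 hj.not_gt⟩
  exact ⟨C, hC, congrIdModTwo_of_colMod (hΓ _ (mul_mem (hle hC) hA)) hcol⟩

theorem mulVec_sigVec_of_mem_closure {g : Fin 5 → GL (Fin 6) ℤ}
    (hg : ∀ i, (g i : Matrix (Fin 6) (Fin 6) ℤ) = sigGen i) {C : GL (Fin 6) ℤ}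
    (hC : C ∈ Subgroup.closure (Set.range g)) :
    (C : Matrix (Fin 6) (Fin 6) ℤ) *ᵥ sigVec = sigVec := by
  induction hC using Subgroup.closure_induction with
  | mem x hx =>
    obtain ⟨i, rfl⟩ := hx
    rw [hg, sigGen_mulVec_sigVec]
  | one => simp
  | mul x y _ _ hx hy => rw [Units.val_mul, ← Matrix.mulVec_mulVec, hy, hx]
  | inv x _ hx =>
    conv_lhs => rw [← hx]
    rw [Matrix.mulVec_mulVec, ← Units.val_mul, inv_mul_cancel, Units.val_one, Matrix.one_mulVec]

/-- `Γ⁵₂` is normal in `Γ⁵`, and `Σ⁵` is a complete set of coset representatives for `Γ⁵₂`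
in `Γ⁵`: every `A ∈ Γ⁵` can be written uniquely as `A = B·C` with `B ∈ Γ⁵₂` and `C ∈ Σ⁵`.
In particular `Γ⁵` is the internal semidirect product of `Γ⁵₂` and `Σ⁵`. -/
theorem gamma5_semidirect_product
    (Γ5 : Subgroup (GL (Fin 6) ℤ))
    (hΓ5 : ∀ A : GL (Fin 6) ℤ, A ∈ Γ5 ↔ IsPosLorentzian (A : Matrix (Fin 6) (Fin 6) ℤ))
    (Γ52 : Subgroup (GL (Fin 6) ℤ))
    (hΓ52 : ∀ A : GL (Fin 6) ℤ, A ∈ Γ52 ↔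
      IsPosLorentzian (A : Matrix (Fin 6) (Fin 6) ℤ) ∧
        CongrIdModTwo (A : Matrix (Fin 6) (Fin 6) ℤ))
    (Sig5 : Subgroup (GL (Fin 6) ℤ))
    (hSig5 : ∃ g12 g23 g34 g45 v : GL (Fin 6) ℤ,
      (g12 : Matrix (Fin 6) (Fin 6) ℤ) = P12 ∧
      (g23 : Matrix (Fin 6) (Fin 6) ℤ) = P23 ∧
      (g34 : Matrix (Fin 6) (Fin 6) ℤ) = P34 ∧
      (g45 : Matrix (Fin 6) (Fin 6) ℤ) = P45 ∧
      (v : Matrix (Fin 6) (Fin 6) ℤ) = Vmat ∧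
      Sig5 = Subgroup.closure {g12, g23, g34, g45, v}) :
    (∀ g ∈ Γ5, ∀ b ∈ Γ52, g * b * g⁻¹ ∈ Γ52) ∧
      ∀ A ∈ Γ5, ∃! BC : GL (Fin 6) ℤ × GL (Fin 6) ℤ,
        BC.1 ∈ Γ52 ∧ BC.2 ∈ Sig5 ∧ A = BC.1 * BC.2 := by
  obtain ⟨g12, g23, g34, g45, v, h12, h23, h34, h45, hv, rfl⟩ := hSig5
  obtain ⟨g, hgdef⟩ : ∃ g : Fin 5 → GL (Fin 6) ℤ, g = ![g12, g23, g34, g45, v] := ⟨_, rfl⟩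
  have hg : ∀ i, (g i : Matrix (Fin 6) (Fin 6) ℤ) = sigGen i := by
    intro i
    subst hgdef
    fin_cases i <;> assumption
  have hrange : ({g12, g23, g34, g45, v} : Set (GL (Fin 6) ℤ)) = Set.range g := by
    rw [hgdef]
    simp only [Matrix.range_cons, Matrix.range_empty, Set.union_empty, Set.singleton_union]
  rw [hrange]
  have hgΓ : ∀ i, g i ∈ Γ5 := fun i => by
    rw [hΓ5, hg]
    exact isPosLorentzian_sigGen i
  have hle : Subgroup.closure (Set.range g) ≤ Γ5 := by
    rw [Subgroup.closure_le]
    rintro _ ⟨i, rfl⟩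
    exact hgΓ i
  have hmem : ∀ A : GL (Fin 6) ℤ, A ∈ Γ52 ↔
      A ∈ Γ5 ∧ Matrix.GeneralLinearGroup.map (Int.castRingHom (ZMod 2)) A = 1 := fun A => by
    rw [hΓ52, hΓ5, congrIdModTwo_iff_map]
  have hnormal : ∀ h ∈ Γ5, ∀ b ∈ Γ52, h * b * h⁻¹ ∈ Γ52 := by
    intro h hh b hb
    rw [hmem] at hb ⊢
    exact ⟨mul_mem (mul_mem hh hb.1) (inv_mem hh), by rw [map_mul, map_mul, hb.2]; simp⟩
  refine ⟨hnormal, fun A hA => ?_⟩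
  obtain ⟨C, hC, hCA⟩ := exists_mem_closure_congrIdModTwo
    (fun B hB => ((hΓ5 B).mp hB).1) hg hgΓ hA
  have hCA' : C * A ∈ Γ52 := (hmem _).mpr
    ⟨mul_mem (hle hC) hA, congrIdModTwo_iff_map.mp hCA⟩
  have hB : A * C ∈ Γ52 := by
    have := hnormal C⁻¹ (inv_mem (hle hC)) _ hCA'
    simpa using this
  refine ⟨(A * C, C⁻¹), ⟨hB, inv_mem hC, by simp⟩, ?_⟩
  rintro ⟨B', C'⟩ ⟨hB', hC', rfl⟩
  dsimp only at hB hB' hC' ⊢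
  have hone : C' * C = 1 := by
    have hΓ : C' * C ∈ Γ52 := by
      have := mul_mem (inv_mem hB') hB
      simpa [mul_assoc] using this
    have hL := (hΓ52 _).mp hΓ
    exact Units.ext (hL.1.1.eq_one hL.2 (mulVec_sigVec_of_mem_closure hg (mul_mem hC' hC)))
  rw [mul_assoc, hone, mul_one, eq_inv_of_mul_eq_one_left hone]
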